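/- arXiv:2605.02177 — 7 statements merged into one kernel-verified Lean document; each statement's English description precedes it below -/
import Mathlib

section
/- Let (pa, r) and (pa', r') be rooted trees on Fin n. If Desc_{pa}(i) = Desc_{pa'}(i) for every i : Fin n, then r = r' and pa = pa'. That is, the collection of descendant sets uniquely determines the rooted tree. -/
/-- Descendant set of `i` under parent map `pa` (including `i` itself). -/
def Desc {n : ℕ} (pa : Fin n → Fin n) (i : Fin n) : Set (Fin n) :=
  {j | ∃ k : ℕ, pa^[k] j = i}

/-- In a rooted tree, a vertex lying on a cycle of the parent map is the root. -/
theorem eq_root_of_iterate_eq_self {α : Type*} {f : α → α} {r v : α} (hr : f r = r)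
    (hreach : ∃ k : ℕ, f^[k] v = r) {p : ℕ} (hp : 0 < p) (hv : f^[p] v = v) : v = r := by
  obtain ⟨k, hk⟩ := hreach
  have hcycle : f^[p * k] v = v := by
    rw [Function.iterate_mul]
    exact Function.iterate_fixed hv k
  obtain ⟨m, hm⟩ := Nat.exists_eq_add_of_le (Nat.le_mul_of_pos_left k hp)
  rw [hm, Nat.add_comm, Function.iterate_add_apply, hk, Function.iterate_fixed hr] at hcycle
  exact hcycle.symm

/-- In a rooted tree, the ancestor relation is antisymmetric. -/
theorem eq_of_iterate_eq_of_iterate_eq {α : Type*} {f : α → α} {r a b : α} (hr : f r = r)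
    (hreach : ∃ k : ℕ, f^[k] a = r) {k m : ℕ} (hab : f^[k] a = b) (hba : f^[m] b = a) :
    a = b := by
  rcases Nat.eq_zero_or_pos k with rfl | hk
  · exact hab
  · have har : a = r := eq_root_of_iterate_eq_self hr hreach (Nat.add_pos_right m hk)
      (by rw [Function.iterate_add_apply, hab, hba])
    rw [← hab, har, Function.iterate_fixed hr]

/-- If the descendant sets agree, a parent distinct from `v` in one tree is an ancestor of the
parent of `v` in the other. -/
theorem parent_mem_Desc_of_Desc_eq {n : ℕ} {pa pa' : Fin n → Fin n}
    (h : ∀ i : Fin n, Desc pa i = Desc pa' i) {v : Fin n} (hv : pa v ≠ v) :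
    pa' v ∈ Desc pa' (pa v) := by
  have hmem : v ∈ Desc pa' (pa v) := h (pa v) ▸ ⟨1, rfl⟩
  obtain ⟨_ | k, hk⟩ := hmem
  · exact absurd hk.symm hv
  · exact ⟨k, hk⟩

/-- The collection of descendant sets uniquely determines the rooted tree. -/
theorem stmt_3 {n : ℕ} (pa pa' : Fin n → Fin n) (r r' : Fin n)
    (hroot_fix : pa r = r) (hreach : ∀ v : Fin n, ∃ k : ℕ, pa^[k] v = r)
    (hroot_fix' : pa' r' = r') (hreach' : ∀ v : Fin n, ∃ k : ℕ, pa'^[k] v = r')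
    (h : ∀ i : Fin n, Desc pa i = Desc pa' i) :
    r = r' ∧ pa = pa' := by
  have hrr : r = r' := by
    have hmem : r' ∈ Desc pa' r := h r ▸ hreach r'
    obtain ⟨k, hk⟩ := hmem
    rw [← hk, Function.iterate_fixed hroot_fix']
  refine ⟨hrr, funext fun v => ?_⟩
  by_cases hv : v = r
  · rw [hv, hroot_fix, hrr, hroot_fix']
  · have hne : pa v ≠ v := fun e =>
      hv (eq_root_of_iterate_eq_self hroot_fix (hreach v) Nat.one_pos e)
    have hne' : pa' v ≠ v := fun e =>
      hv (hrr ▸ eq_root_of_iterate_eq_self hroot_fix' (hreach' v) Nat.one_pos e)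
    have hmem : pa' v ∈ Desc pa (pa v) := h (pa v) ▸ parent_mem_Desc_of_Desc_eq h hne
    obtain ⟨k, hk⟩ := hmem
    obtain ⟨m, hm⟩ := parent_mem_Desc_of_Desc_eq (fun i => (h i).symm) hne'
    exact eq_of_iterate_eq_of_iterate_eq hroot_fix (hreach _) hm hk
end

section
/- For a rooted tree (pa, r) on Fin n and i : Fin n, define the intervened outcome map Φ_{pa,r,i} : Bool → (Fin n → Bool) by Φ_{pa,r,i}(u) j = false if j ∈ Desc(i) and Φ_{pa,r,i}(u) j = u otherwise. Then the map sending a rooted tree (pa, r) to the family (i : Fin n) ↦ Φ_{pa,r,i} is injective: two rooted trees with the same family of intervened outcome maps are equal. -/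
open Classical in
/-- Intervened outcome map of the rooted-tree SCM under `do(X_i = 0)` with root
noise `u`: descendants of `i` read `false`, all other nodes read `u`. -/
noncomputable def Phi {n : ℕ} (pa : Fin n → Fin n) (i : Fin n) (u : Bool) :
    Fin n → Bool :=
  fun j => if j ∈ Desc pa i then false else u

theorem mem_Desc_iff_of_Phi_eq {n : ℕ} {pa pa' : Fin n → Fin n}
    (h : ∀ (i : Fin n) (u : Bool), Phi pa i u = Phi pa' i u) (i j : Fin n) :
    j ∈ Desc pa i ↔ j ∈ Desc pa' i := by
  have := congrFun (h i true) j
  unfold Phi at this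
  split_ifs at this <;> simp_all

theorem eq_root_of_isPeriodicPt {α : Type*} {f : α → α} {r a : α} (hr : f r = r)
    (ha : ∃ k : ℕ, f^[k] a = r) {p : ℕ} (hp : 0 < p) (h : Function.IsPeriodicPt f p a) :
    a = r := by
  obtain ⟨k, hk⟩ := ha
  have hle : k ≤ p * k := Nat.le_mul_of_pos_left k hp
  have hfix : f^[p * k] a = a := h.mul_const k
  rw [← hfix, ← Nat.sub_add_cancel hle, Function.iterate_add_apply, hk]
  exact Function.iterate_fixed hr _

theorem Desc_antisymm {n : ℕ} {pa : Fin n → Fin n} {r : Fin n} (hr : pa r = r)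
    (hreach : ∀ v : Fin n, ∃ k : ℕ, pa^[k] v = r) {a b : Fin n}
    (hab : a ∈ Desc pa b) (hba : b ∈ Desc pa a) : a = b := by
  obtain ⟨k, hk⟩ := hab
  obtain ⟨l, hl⟩ := hba
  rcases Nat.eq_zero_or_pos k with rfl | hpos
  · exact hk
  · have ha : a = r := eq_root_of_isPeriodicPt hr (hreach a) (p := l + k) (by omega) (by
      change pa^[l + k] a = a
      rw [Function.iterate_add_apply, hk, hl])
    subst ha
    rw [← hk, Function.iterate_fixed hr]

theorem parent_mem_Desc {n : ℕ} {pa : Fin n → Fin n} {v i : Fin n}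
    (h : v ∈ Desc pa i) (hne : v ≠ i) : pa v ∈ Desc pa i := by
  obtain ⟨_ | k, hk⟩ := h
  · exact absurd hk hne
  · exact ⟨k, hk⟩

/-- The map from a rooted tree to its family of intervened outcome maps is
injective. -/
theorem stmt_5 {n : ℕ} (pa pa' : Fin n → Fin n) (r r' : Fin n)
    (hroot_fix : pa r = r) (hreach : ∀ v : Fin n, ∃ k : ℕ, pa^[k] v = r)
    (hroot_fix' : pa' r' = r') (hreach' : ∀ v : Fin n, ∃ k : ℕ, pa'^[k] v = r')
    (h : ∀ (i : Fin n) (u : Bool), Phi pa i u = Phi pa' i u) :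
    pa = pa' ∧ r = r' := by
  have hD := mem_Desc_iff_of_Phi_eq h
  have hrr : r = r' :=
    Desc_antisymm hroot_fix hreach ((hD r' r).2 (hreach' r)) (hreach r')
  subst hrr
  refine ⟨funext fun v => ?_, rfl⟩
  by_cases hv : v = r
  · rw [hv, hroot_fix, hroot_fix']
  have hne : v ≠ pa v := fun e =>
    hv (eq_root_of_isPeriodicPt hroot_fix (hreach v) one_pos e.symm)
  have hne' : v ≠ pa' v := fun e =>
    hv (eq_root_of_isPeriodicPt hroot_fix' (hreach' v) one_pos e.symm)
  exact Desc_antisymm hroot_fix hreach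
    (parent_mem_Desc ((hD (pa' v) v).2 ⟨1, rfl⟩) hne')
    ((hD _ _).2 (parent_mem_Desc ((hD (pa v) v).1 ⟨1, rfl⟩) hne))
end

section
/- For every n ≥ 1, the number of parent maps pa : Fin n → Fin n for which there exists a root r with pa r = r and ∀ v, ∃ k, pa^[k] v = r, equals n^(n−1). (Equivalently: there are exactly n^(n−1) rooted labeled trees on n vertices.) -/
open Finset Function

namespace RootedForest

/-- A self-map is a parent map of a rooted forest if every orbit reaches a fixed point;
the fixed points are the roots. -/
def IsForest {V : Type*} (f : V → V) : Prop :=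
  ∀ v, ∃ k : ℕ, f (f^[k] v) = f^[k] v

section

variable {V : Type*}

theorem iterate_eq_of_le {f : V → V} {v : V} {i j : ℕ}
    (hi : f (f^[i] v) = f^[i] v) (hij : i ≤ j) : f^[j] v = f^[i] v := by
  obtain ⟨d, rfl⟩ := Nat.exists_eq_add_of_le' hij
  rw [iterate_add_apply]
  exact iterate_fixed hi d

variable [DecidableEq V]

theorem IsForest.update_self {g : V → V} (hg : IsForest g) (s : V) :
    IsForest (update g s s) := by
  intro v
  obtain ⟨k, hk⟩ := hg v
  induction k generalizing v with
  | zero =>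
    refine ⟨0, ?_⟩
    by_cases h : v = s
    · simp [h]
    · simpa [h] using hk
  | succ k ih =>
    by_cases h : v = s
    · exact ⟨0, by simp [h]⟩
    · obtain ⟨j, hj⟩ := ih (g v) hk
      exact ⟨j + 1, by simpa [h] using hj⟩

theorem exists_iterate_eq_of_update {g : V → V} {s v : V} (x : V)
    (h : ∃ k : ℕ, (update g s x)^[k] v = s) : ∃ k : ℕ, g^[k] v = s := by
  obtain ⟨k, hk⟩ := h
  induction k generalizing v with
  | zero => exact ⟨0, hk⟩
  | succ k ih =>
    by_cases h : v = s
    · exact ⟨0, h⟩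
    · obtain ⟨j, hj⟩ := ih (v := g v) (by simpa [h] using hk)
      exact ⟨j + 1, hj⟩

theorem IsForest.not_exists_iterate_eq {g : V → V} (hg : IsForest g) {s : V} (hs : g s ≠ s) :
    ¬ ∃ k : ℕ, (update g s s)^[k] (g s) = s := by
  intro h
  obtain ⟨k, hk⟩ := exists_iterate_eq_of_update s h
  obtain ⟨j, hj⟩ := hg s
  have hper : IsPeriodicPt g (k + 1) s := hk
  have h1 : g^[(k + 1) * j] s = s := hper.mul_const j
  rw [iterate_eq_of_le hj (Nat.le_mul_of_pos_left j k.succ_pos)] at h1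
  rw [h1] at hj
  exact hs hj

theorem IsForest.update {f : V → V} (hf : IsForest f) {s w : V}
    (hw : ¬ ∃ k : ℕ, f^[k] w = s) : IsForest (update f s w) := by
  have hiter : ∀ k : ℕ, (Function.update f s w)^[k] w = f^[k] w := by
    intro k
    induction k with
    | zero => rfl
    | succ k ih =>
      rw [iterate_succ_apply', iterate_succ_apply', ih,
        update_of_ne fun h => hw ⟨k, h⟩]
  have hforest : ∃ k : ℕ, Function.update f s w ((Function.update f s w)^[k] w) =
      (Function.update f s w)^[k] w := by
    obtain ⟨k, hk⟩ := hf w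
    refine ⟨k, ?_⟩
    rw [hiter, update_of_ne fun h => hw ⟨k, h⟩, hk]
  have hroot : ∃ k : ℕ, Function.update f s w ((Function.update f s w)^[k] s) =
      (Function.update f s w)^[k] s := by
    obtain ⟨j, hj⟩ := hforest
    exact ⟨j + 1, by simpa using hj⟩
  intro v
  obtain ⟨k, hk⟩ := hf v
  induction k generalizing v with
  | zero =>
    by_cases h : v = s
    · exact h ▸ hroot
    · exact ⟨0, by simpa [h] using hk⟩
  | succ k ih =>
    by_cases h : v = s
    · exact h ▸ hroot
    · obtain ⟨j, hj⟩ := ih (f v) hk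
      exact ⟨j + 1, by simpa [h] using hj⟩

end

section

variable {V : Type*} [Fintype V] [DecidableEq V]

/-- The set of roots of a parent map. -/
def roots (f : V → V) : Finset V := {v | f v = v}

@[simp]
theorem mem_roots {f : V → V} {v : V} : v ∈ roots f ↔ f v = v := by
  simp [roots]

theorem roots_update_self (g : V → V) (s : V) : roots (update g s s) = insert s (roots g) := by
  ext v
  by_cases h : v = s <;> simp [h]

theorem roots_update_of_ne (f : V → V) {s w : V} (h : w ≠ s) :
    roots (update f s w) = (roots f).erase s := by
  ext v
  by_cases hv : v = s
  · subst hv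
    simpa using h
  · simp [hv]

open Classical in
/-- The parent maps of rooted forests on `V` with exactly `k` roots. -/
noncomputable def forests (V : Type*) [Fintype V] [DecidableEq V] (k : ℕ) : Finset (V → V) :=
  {f | IsForest f ∧ #(roots f) = k}

theorem mem_forests {k : ℕ} {f : V → V} : f ∈ forests V k ↔ IsForest f ∧ #(roots f) = k := by
  simp [forests]

open Classical in
/-- The pairs `(s, w)` of a root `s` and a vertex `w` outside the tree of `s`: attaching `s`
to `w` yields a forest again. -/
noncomputable def links (f : V → V) : Finset (V × V) :=
  {p ∈ roots f ×ˢ univ | ¬ ∃ k : ℕ, f^[k] p.2 = p.1}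

theorem mem_links {f : V → V} {p : V × V} :
    p ∈ links f ↔ f p.1 = p.1 ∧ ¬ ∃ k : ℕ, f^[k] p.2 = p.1 := by
  simp [links]

theorem IsForest.card_links_add {f : V → V} (hf : IsForest f) :
    #(links f) + Fintype.card V = #(roots f) * Fintype.card V := by
  classical
  have hbad : #{p ∈ roots f ×ˢ (univ : Finset V) | ∃ k : ℕ, f^[k] p.2 = p.1} =
      Fintype.card V := by
    rw [← card_univ]
    refine card_bij (fun p _ => p.2) (fun _ _ => mem_univ _) ?_ ?_
    · rintro ⟨s, v⟩ hs ⟨t, w⟩ ht hvw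
      simp only [mem_filter, mem_product, mem_roots, mem_univ, and_true] at hs ht hvw
      subst hvw
      obtain ⟨hs, i, hi⟩ := hs
      obtain ⟨ht, j, hj⟩ := ht
      have : s = t := by
        rcases le_total i j with hij | hij
        · rw [← hi, ← hj, iterate_eq_of_le (by rw [hi, hs]) hij]
        · rw [← hi, ← hj, iterate_eq_of_le (by rw [hj, ht]) hij]
      rw [this]
    · intro v _
      obtain ⟨k, hk⟩ := hf v
      exact ⟨(f^[k] v, v), by simpa using hk, rfl⟩
  have := card_filter_add_card_filter_not (s := roots f ×ˢ (univ : Finset V))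
    (fun p => ∃ k : ℕ, f^[k] p.2 = p.1)
  rw [hbad, card_product, card_univ] at this
  rw [← this, add_comm, links]

/-- Double counting of the ways to attach a root of a forest to a vertex of another tree. -/
theorem card_forests_mul (k : ℕ) :
    #(forests V k) * (Fintype.card V - k) =
      #(forests V (k + 1)) * (k * Fintype.card V) := by
  have hleft : #((forests V k).sigma fun g => (roots g)ᶜ) =
      #(forests V k) * (Fintype.card V - k) := by
    rw [card_sigma]
    refine sum_const_nat fun g hg => ?_
    rw [card_compl, (mem_forests.1 hg).2]
  have hright : #((forests V (k + 1)).sigma fun f => links f) =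
      #(forests V (k + 1)) * (k * Fintype.card V) := by
    rw [card_sigma]
    refine sum_const_nat fun f hf => ?_
    obtain ⟨hf, hk⟩ := mem_forests.1 hf
    have := hf.card_links_add
    rw [hk, add_mul, one_mul] at this
    exact Nat.add_right_cancel this
  rw [← hleft, ← hright]
  refine card_bij' (fun x _ => ⟨update x.1 x.2 x.2, x.2, x.1 x.2⟩)
    (fun y _ => ⟨update y.1 y.2.1 y.2.2, y.2.1⟩) ?_ ?_ ?_ ?_
  · rintro ⟨g, s⟩ h
    simp only [mem_sigma, mem_compl, mem_roots, mem_forests, mem_links] at h ⊢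
    obtain ⟨⟨hg, hk⟩, hs⟩ := h
    refine ⟨⟨hg.update_self s, ?_⟩, by simp, hg.not_exists_iterate_eq hs⟩
    rw [roots_update_self, card_insert_of_notMem (by simpa using hs), hk]
  · rintro ⟨f, s, w⟩ h
    simp only [mem_sigma, mem_compl, mem_roots, mem_forests, mem_links] at h ⊢
    obtain ⟨⟨hf, hk⟩, hs, hw⟩ := h
    have hne : w ≠ s := fun h => hw ⟨0, h⟩
    refine ⟨⟨hf.update hw, ?_⟩, by simpa using hne⟩
    rw [roots_update_of_ne f hne, card_erase_of_mem (by simpa using hs), hk,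
      Nat.add_sub_cancel]
  · rintro ⟨g, s⟩ _
    simp
  · rintro ⟨f, s, w⟩ h
    simp only [mem_sigma, mem_links] at h
    have : update f s s = f := by
      conv_lhs => rw [← h.2.1]
      simp [h.2.1]
    simp [this]

theorem forests_card_self : forests V (Fintype.card V) = {id} := by
  ext f
  rw [mem_forests, mem_singleton, card_eq_iff_eq_univ, eq_univ_iff_forall]
  constructor
  · rintro ⟨_, h⟩
    exact funext fun v => mem_roots.1 (h v)
  · rintro rfl
    exact ⟨fun v => ⟨0, rfl⟩, fun v => by simp⟩

/-- The number of rooted forests with `k + 1` roots on `N + 1` labeled vertices. -/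
theorem card_forests {N k : ℕ} (hV : Fintype.card V = N + 1) (hk : k ≤ N) :
    #(forests V (k + 1)) = N.choose k * (N + 1) ^ (N - k) := by
  induction hk using Nat.decreasingInduction with
  | self => simp [← hV, forests_card_self]
  | of_succ k hk ih =>
    have hrec := card_forests_mul (V := V) (k + 1)
    rw [ih, hV, Nat.add_sub_add_right] at hrec
    have hpos : 0 < N - k := Nat.sub_pos_of_lt hk
    refine Nat.eq_of_mul_eq_mul_right hpos ?_
    rw [hrec, show N - k = N - (k + 1) + 1 by omega, pow_succ]
    have hchoose := Nat.choose_succ_right_eq N k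
    rw [show N - k = N - (k + 1) + 1 by omega] at hchoose
    linear_combination (N + 1) ^ (N - (k + 1)) * (N + 1) * hchoose

theorem mem_forests_one {f : V → V} :
    f ∈ forests V 1 ↔ ∃ r, f r = r ∧ ∀ v, ∃ k : ℕ, f^[k] v = r := by
  rw [mem_forests, card_eq_one]
  constructor
  · rintro ⟨hf, r, hr⟩
    have hroot : ∀ v, f v = v ↔ v = r := fun v => by
      rw [← mem_roots, hr, mem_singleton]
    refine ⟨r, (hroot r).2 rfl, fun v => ?_⟩
    obtain ⟨k, hk⟩ := hf v
    exact ⟨k, (hroot _).1 hk⟩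
  · rintro ⟨r, hr, h⟩
    refine ⟨fun v => ?_, r, ?_⟩
    · obtain ⟨k, hk⟩ := h v
      exact ⟨k, by rw [hk, hr]⟩
    · ext v
      rw [mem_roots, mem_singleton]
      refine ⟨fun hv => ?_, fun hv => hv ▸ hr⟩
      obtain ⟨k, hk⟩ := h v
      rw [← hk, iterate_fixed hv]

end

end RootedForest

/-- Cayley's formula, rooted form: there are exactly `n^(n-1)` parent maps on
`Fin n` admitting a root, i.e. rooted labeled trees on `n` vertices. -/
theorem stmt_6 (n : ℕ) (hn : 1 ≤ n) :
    Nat.card {pa : Fin n → Fin n //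
      ∃ r : Fin n, pa r = r ∧ ∀ v : Fin n, ∃ k : ℕ, pa^[k] v = r} = n ^ (n - 1) := by
  obtain ⟨N, rfl⟩ := Nat.exists_eq_add_of_le' hn
  rw [Nat.subtype_card (RootedForest.forests (Fin (N + 1)) 1)
      fun _ => RootedForest.mem_forests_one,
    RootedForest.card_forests (k := 0) (Fintype.card_fin _) N.zero_le]
  simp
end

section
/- The map sending a bipartite graph G : Fin m → Fin m → Bool to its family of intervened outcome maps (i : Fin m) ↦ ((u : Bool) ↦ int_G(i, u)) is injective: if two graphs G and G' satisfy int_G(i, u) = int_{G'}(i, u) for all i and u, then G = G'. -/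
/-- Intervened state of the bipartite SCM `M_G` under `do(X_{a_i} = 0)` with
root noise `u`. -/
def intv {m : ℕ} (G : Fin m → Fin m → Bool) (i : Fin m) (u : Bool) :
    Bool × (Fin m → Bool) × (Fin m → Bool) :=
  (u, fun k => if k = i then false else u,
      fun j => u && decide (∀ k : Fin m, G k j = true → (if k = i then false else u) = true))

/-- Under `do(X_{a_i} = 0)` with noise `true`, node `b_j` is off exactly when `a_i` is a parent
of `b_j`. -/
theorem intv_true_snd_snd {m : ℕ} (G : Fin m → Fin m → Bool) (i j : Fin m) :
    (intv G i true).2.2 j = !G i j := by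
  cases hG : G i j
  · suffices ∀ k, G k j = true → ¬k = i by simpa [intv]
    rintro k hk rfl
    simp [hG] at hk
  · simp [intv, hG]

/-- The map from a bipartite graph to its family of intervened outcome maps is
injective. -/
theorem stmt_9 {m : ℕ} (G G' : Fin m → Fin m → Bool)
    (h : ∀ (i : Fin m) (u : Bool), intv G i u = intv G' i u) :
    G = G' := by
  funext i j
  have hij := congrArg (fun s => s.2.2 j) (h i true)
  simpa [intv_true_snd_snd] using hij
end

section
/- Let G, G' : Fin m → Fin m → Bool be distinct bipartite graphs. Then there exists i : Fin m such that the pushforwards P = PMF.map (fun u => int_G(i, u)) (uniform on Bool) and P' = PMF.map (fun u => int_{G'}(i, u)) (uniform on Bool) satisfy ∑_x |P(x) − P'(x)| ≥ 1, i.e., the total variation distance between the two do(X_{a_i} = 0) interventional distributions is at least 1/2. -/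
theorem toReal_map_uniformOfFintype_bool {α : Type*} [DecidableEq α] (f : Bool → α) (x : α) :
    ((PMF.map f (PMF.uniformOfFintype Bool)) x).toReal =
      (if x = f true then 1 / 2 else 0) + (if x = f false then 1 / 2 else 0) := by
  rw [PMF.map_apply, tsum_fintype, Fintype.sum_bool, ENNReal.toReal_add]
  · congr 1 <;> split_ifs <;> simp
  all_goals split_ifs <;> simp

/-- Two pushforwards of a fair coin are at `L¹` distance at least `1` if the image of `true`
under either map is not attained by the other. -/
theorem one_le_sum_abs_map_uniformOfFintype_bool {α : Type*} [Fintype α] (f g : Bool → α)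
    (h : f true ≠ g true) (hfg : f true ≠ g false) (hgf : g true ≠ f false) :
    1 ≤ ∑ x : α, |((PMF.map f (PMF.uniformOfFintype Bool)) x).toReal -
      ((PMF.map g (PMF.uniformOfFintype Bool)) x).toReal| := by
  classical
  refine le_trans ?_ (Finset.sum_le_sum_of_subset_of_nonneg
    (Finset.subset_univ {f true, g true}) fun _ _ _ => abs_nonneg _)
  rw [Finset.sum_pair h]
  simp only [toReal_map_uniformOfFintype_bool, h, h.symm, hfg, hgf, if_true, if_false]
  split_ifs <;> norm_num

/-- Distinct bipartite graphs admit an intervention `do(X_{a_i} = 0)` whose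
interventional distributions are at total variation distance at least `1/2`,
i.e. the L¹ distance between the pushforward PMFs is at least `1`. -/
theorem stmt_10 {m : ℕ} (G G' : Fin m → Fin m → Bool) (hne : G ≠ G') :
    ∃ i : Fin m,
      1 ≤ ∑ x : Bool × (Fin m → Bool) × (Fin m → Bool),
        |((PMF.map (intv G i) (PMF.uniformOfFintype Bool)) x).toReal -
          ((PMF.map (intv G' i) (PMF.uniformOfFintype Bool)) x).toReal| := by
  obtain ⟨i, hi⟩ := Function.ne_iff.mp hne
  obtain ⟨j, hj⟩ := Function.ne_iff.mp hi
  refine ⟨i, one_le_sum_abs_map_uniformOfFintype_bool _ _ (fun h => hj ?_) ?_ ?_⟩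
  · have := congrArg (fun x => x.2.2 j) h
    simpa only [intv_true_snd_snd, Bool.not_inj_iff] using this
  all_goals simp [intv]
end

section
/- For every s : Fin m → Bool, the pushforward of the uniform distribution on Fin m → (Bool × Bool) under the map sending uv to the function t ↦ mech (s t) (uv t) equals the uniform distribution on Fin m → (Bool × Bool). That is, the observational distribution of the modular-XOR SCM M_s is uniform on {0,1}^{2m} for every hidden string s. -/
/-- XOR-module mechanism: `mech s (u, v) = (u, if s then u ⊕ v else v)`. -/
def mech (s : Bool) : Bool × Bool → Bool × Bool :=
  fun uv => (uv.1, if s then xor uv.1 uv.2 else uv.2)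

theorem mech_involutive (s : Bool) : Function.Involutive (mech s) := by
  rintro ⟨u, v⟩
  cases s <;> simp [mech]

theorem PMF.map_equiv_uniformOfFintype {α β : Type*} [Fintype α] [Nonempty α]
    [Fintype β] [Nonempty β] (e : α ≃ β) :
    PMF.map e (PMF.uniformOfFintype α) = PMF.uniformOfFintype β := by
  classical
  ext b
  rw [PMF.map_apply, tsum_eq_single (e.symm b)]
  · simp [Fintype.card_congr e]
  · intro a ha
    rw [if_neg]
    rintro rfl
    simp at ha

/-- The observational distribution of the modular-XOR SCM `M_s` is uniform on
`{0,1}^{2m}` for every hidden string `s`. -/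
theorem stmt_13 {m : ℕ} (s : Fin m → Bool) :
    PMF.map (fun uv : Fin m → Bool × Bool => fun t : Fin m => mech (s t) (uv t))
        (PMF.uniformOfFintype (Fin m → Bool × Bool)) =
      PMF.uniformOfFintype (Fin m → Bool × Bool) := by
  exact PMF.map_equiv_uniformOfFintype
    (Equiv.piCongrRight fun t => (mech_involutive (s t)).toPerm)
end

section
/- Let (Ω, μ) be a probability space, P : Ω → ℝ a random variable with μ {ω | P ω = 1} = 1/2 and μ {ω | P ω = 1/2} = 1/2, and A : Ω → ℝ an integrable random variable independent of P (IndepFun A P μ). Then ∫ |A ω − P ω| dμ(ω) ≥ 1/4. -/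
open MeasureTheory ProbabilityTheory

/-- On the event `P = c`, an independent `A` has mean distance `E|A - c|` to `c`,
weighted by the probability of the event. -/
lemma integral_abs_sub_mul_indicator {Ω : Type*} [MeasurableSpace Ω] {μ : Measure Ω}
    {P A : Ω → ℝ} (hP : Measurable P) (hA : AEStronglyMeasurable A μ)
    (hindep : IndepFun A P μ) (c : ℝ) :
    ∫ ω, |A ω - c| * {ω | P ω = c}.indicator 1 ω ∂μ
      = (∫ ω, |A ω - c| ∂μ) * μ.real {ω | P ω = c} := by
  have hS : MeasurableSet {ω | P ω = c} := hP (measurableSet_singleton c)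
  have hind : IndepFun (fun ω => |A ω - c|) ({ω | P ω = c}.indicator (1 : Ω → ℝ)) μ := by
    have hg : Measurable (({c} : Set ℝ).indicator (1 : ℝ → ℝ)) :=
      measurable_one.indicator (measurableSet_singleton c)
    exact hindep.comp (φ := fun x => |x - c|) (by fun_prop) hg
  have hm : AEStronglyMeasurable (fun ω => |A ω - c|) μ :=
    (hA.sub aestronglyMeasurable_const).norm
  rw [hind.integral_fun_mul_eq_mul_integral hm
    (measurable_one.indicator hS).aestronglyMeasurable, integral_indicator_one hS]

/-- Per-query prediction-error bound: if `P` equals `1` with probability `1/2`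
and `1/2` with probability `1/2`, and the predictor `A` is independent of `P`,
then the expected absolute error is at least `1/4`. -/
theorem stmt_19 {Ω : Type*} [MeasurableSpace Ω]
    (μ : Measure Ω) [IsProbabilityMeasure μ]
    (P A : Ω → ℝ) (hP : Measurable P)
    (hP1 : μ {ω | P ω = 1} = 1 / 2)
    (hPhalf : μ {ω | P ω = 1 / 2} = 1 / 2)
    (hA : Integrable A μ)
    (hindep : IndepFun A P μ) :
    1 / 4 ≤ ∫ ω, |A ω - P ω| ∂μ := by
  have hS (c : ℝ) : MeasurableSet {ω | P ω = c} := hP (measurableSet_singleton c)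
  have hdisj : Disjoint {ω | P ω = 1} {ω | P ω = 1 / 2} := by
    rw [Set.disjoint_left]
    intro ω h1 h2
    simp only [Set.mem_ofPred_eq] at h1 h2
    linarith
  have hunion : μ ({ω | P ω = 1} ∪ {ω | P ω = 1 / 2}) = 1 := by
    rw [measure_union hdisj (hS _), hP1, hPhalf, ENNReal.add_halves]
  have hae : ∀ᵐ ω ∂μ, ω ∈ {ω | P ω = 1} ∪ {ω | P ω = 1 / 2} :=
    (mem_ae_iff_prob_eq_one ((hS _).union (hS _))).2 hunion
  have hintegrable (c : ℝ) : Integrable (fun ω => |A ω - c|) μ :=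
    (hA.sub (integrable_const c)).abs
  have hintegrable_mul (c : ℝ) :
      Integrable (fun ω => |A ω - c| * {ω | P ω = c}.indicator 1 ω) μ := by
    refine ((hintegrable c).indicator (hS c)).congr (.of_forall fun ω => ?_)
    by_cases h : P ω = c <;> simp [Set.indicator, h]
  have hsplit : ∫ ω, |A ω - P ω| ∂μ
      = ∫ ω, (|A ω - 1| * {ω | P ω = 1}.indicator 1 ω
        + |A ω - 1 / 2| * {ω | P ω = 1 / 2}.indicator 1 ω) ∂μ := by
    refine integral_congr_ae ?_
    filter_upwards [hae] with ω hω
    rcases hω with h | h <;> simp only [Set.mem_ofPred_eq] at h <;>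
      norm_num [Set.indicator, h]
  have hlower : (1 / 2 : ℝ) ≤ ∫ ω, (|A ω - 1| + |A ω - 1 / 2|) ∂μ := by
    calc (1 / 2 : ℝ) = ∫ _, (1 / 2 : ℝ) ∂μ := by simp
      _ ≤ _ := integral_mono (integrable_const _) ((hintegrable 1).add (hintegrable (1 / 2))) fun ω => by
        have h1 := neg_abs_le (A ω - 1)
        have h2 := le_abs_self (A ω - 1 / 2)
        dsimp only [Pi.add_apply]
        linarith
  rw [integral_add (hintegrable 1) (hintegrable (1 / 2))] at hlower
  rw [hsplit, integral_add (hintegrable_mul 1) (hintegrable_mul (1 / 2)),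
    integral_abs_sub_mul_indicator hP hA.aestronglyMeasurable hindep,
    integral_abs_sub_mul_indicator hP hA.aestronglyMeasurable hindep,
    measureReal_def, measureReal_def, hP1, hPhalf]
  have hhalf : (1 / 2 : ENNReal).toReal = 1 / 2 := by simp
  rw [hhalf]
  linarith
end
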